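/- Criterion for the existence of non-optimal stationary points: suppose ᾱ is an interior point of D (as a subset of ℝ^m), that F is Fréchet differentiable at ᾱ, and that the linear span V := span{F(ᾱ), ∂₁F(ᾱ), …, ∂_m F(ᾱ)} of the value and the partial derivatives of F at ᾱ is not equal to Y. Then for every v in the orthogonal complement of V with ‖v‖ = 1 and every s ∈ ℝ with |s| > (Θ/(1 − Θ))^{1/2}·‖F(ᾱ)‖ there exists τ ∈ {−1, 1} such that, with y := F(ᾱ) + τ·s·v, the point ᾱ is a spurious local minimum or a saddle point of L_y, i.e.: the derivative of L_y vanishes at ᾱ, ᾱ is not a global minimizer of L_y, and ᾱ is either a local minimizer of L_y or not a local maximizer of L_y. Moreover, for every C > 0 there exist uncountably many y ∈ Y such that ᾱ is a spurious local minimum or saddle point of L_y in this sense and additionally ‖F(ᾱ) − z‖ ≥ C and ‖F(ᾱ) − z‖/‖z‖ ≥ 1 − 1/C for every z ∈ P(y), and inf_{α ∈ D} L_y(α) + C ≤ L_y(ᾱ). -/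

import Mathlib

open Filter Metric
open scoped InnerProductSpace

noncomputable section

/-- The optimal value of the squared loss `inf_{α ∈ D} ‖F α - y‖²`. -/
def lossInf {Y : Type} [NormedAddCommGroup Y] {m : ℕ}
    (D : Set (Fin m → ℝ)) (F : (Fin m → ℝ) → Y) (y : Y) : ℝ :=
  sInf ((fun α => ‖F α - y‖ ^ 2) '' D)

/-- The worst-case error bound `Θ = sup_{‖y‖ = 1} inf_{α ∈ D} ‖F α - y‖²`. -/
def Theta {Y : Type} [NormedAddCommGroup Y] {m : ℕ}
    (D : Set (Fin m → ℝ)) (F : (Fin m → ℝ) → Y) : ℝ :=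
  sSup ((fun y => lossInf D F y) '' {y : Y | ‖y‖ = 1})

/-- The set of best approximations of `y` in `closure (F '' D)`. -/
def bestApprox {Y : Type} [NormedAddCommGroup Y] {m : ℕ}
    (D : Set (Fin m → ℝ)) (F : (Fin m → ℝ) → Y) (y : Y) : Set Y :=
  {z | z ∈ closure (F '' D) ∧ ‖z - y‖ = Metric.infDist y (closure (F '' D))}

/-- `abar` is a spurious local minimum or a saddle point of the squared loss with label `y`:
the derivative of the loss vanishes at `abar`, `abar` is not a global minimizer on `D`, and
`abar` is a local minimizer on `D` or not a local maximizer on `D`. -/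
def spuriousOrSaddle {Y : Type} [NormedAddCommGroup Y] [NormedSpace ℝ Y] {m : ℕ}
    (D : Set (Fin m → ℝ)) (F : (Fin m → ℝ) → Y) (abar : Fin m → ℝ) (y : Y) : Prop :=
  HasFDerivAt (fun α => ‖F α - y‖ ^ 2) (0 : (Fin m → ℝ) →L[ℝ] ℝ) abar ∧
  ¬ IsMinOn (fun α => ‖F α - y‖ ^ 2) D abar ∧
  (IsLocalMinOn (fun α => ‖F α - y‖ ^ 2) D abar ∨
    ¬ IsLocalMaxOn (fun α => ‖F α - y‖ ^ 2) D abar)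

section LossInf

variable {Y : Type} [NormedAddCommGroup Y] {m : ℕ} {D : Set (Fin m → ℝ)} {F : (Fin m → ℝ) → Y}

lemma lossInf_eq_infDist_sq (hD : D.Nonempty) (y : Y) :
    lossInf D F y = infDist y (F '' D) ^ 2 := by
  have hbdd : BddBelow ((fun α => ‖F α - y‖ ^ 2) '' D) :=
    ⟨0, by rintro _ ⟨α, -, rfl⟩; positivity⟩
  apply le_antisymm
  · rw [← Real.sqrt_le_left infDist_nonneg, le_infDist (hD.image F)]
    rintro _ ⟨α, hα, rfl⟩
    rw [dist_comm, dist_eq_norm]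
    exact (Real.sqrt_le_left (norm_nonneg _)).2 (csInf_le hbdd ⟨α, hα, rfl⟩)
  · refine le_csInf (hD.image _) ?_
    rintro _ ⟨α, hα, rfl⟩
    have h := infDist_le_dist_of_mem (x := y) (Set.mem_image_of_mem F hα)
    rw [dist_comm, dist_eq_norm] at h
    exact pow_le_pow_left₀ infDist_nonneg h 2

lemma lossInf_nonneg (hD : D.Nonempty) (y : Y) : 0 ≤ lossInf D F y := by
  rw [lossInf_eq_infDist_sq hD]
  positivity

lemma IsMinOn.sq_norm_le_lossInf (hD : D.Nonempty) {a : Fin m → ℝ} {y : Y}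
    (h : IsMinOn (fun α => ‖F α - y‖ ^ 2) D a) : ‖F a - y‖ ^ 2 ≤ lossInf D F y := by
  refine le_csInf (hD.image _) ?_
  rintro _ ⟨α, hα, rfl⟩
  exact h hα

lemma bddAbove_lossInf_sphere (hexpr : ∀ y : Y, y ≠ 0 → lossInf D F y < ‖y‖ ^ 2) :
    BddAbove ((fun y => lossInf D F y) '' {y : Y | ‖y‖ = 1}) := by
  refine ⟨1, ?_⟩
  rintro _ ⟨y, hy, rfl⟩
  have hy1 : ‖y‖ = 1 := hy
  simpa [hy1] using (hexpr y (norm_ne_zero_iff.1 (by simp [hy1]))).le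

lemma Theta_nonneg (hD : D.Nonempty) : 0 ≤ Theta D F := by
  refine Real.sSup_nonneg ?_
  rintro _ ⟨y, -, rfl⟩
  exact lossInf_nonneg hD y

lemma norm_sub_sqrt_lossInf_le_of_mem_bestApprox (hD : D.Nonempty) {y z : Y}
    (hz : z ∈ bestApprox D F y) : ‖y‖ - √(lossInf D F y) ≤ ‖z‖ := by
  have h := hz.2
  rw [infDist_closure] at h
  rw [lossInf_eq_infDist_sq hD, Real.sqrt_sq infDist_nonneg, ← h]
  have := norm_sub_norm_le y z
  rw [norm_sub_rev] at this
  linarith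

variable [NormedSpace ℝ Y]

open scoped Pointwise in
lemma lossInf_smul_le (hD : D.Nonempty)
    (hcone : ∀ y ∈ F '' D, ∀ s : ℝ, 0 < s → s • y ∈ F '' D) {t : ℝ} (ht : 0 < t) (y : Y) :
    lossInf D F (t • y) ≤ t ^ 2 * lossInf D F y := by
  rw [lossInf_eq_infDist_sq hD, lossInf_eq_infDist_sq hD, ← mul_pow]
  refine pow_le_pow_left₀ infDist_nonneg ?_ 2
  have hsub : t • (F '' D) ⊆ F '' D := by
    rintro _ ⟨z, hz, rfl⟩
    exact hcone z hz t ht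
  have h := infDist_le_infDist_of_subset (x := t • y) hsub (hD.image F).smul_set
  rwa [infDist_smul₀ ht.ne', Real.norm_of_nonneg ht.le] at h

lemma lossInf_le_Theta_mul (hD : D.Nonempty)
    (hcone : ∀ y ∈ F '' D, ∀ s : ℝ, 0 < s → s • y ∈ F '' D)
    (hexpr : ∀ y : Y, y ≠ 0 → lossInf D F y < ‖y‖ ^ 2) {y : Y} (hy : y ≠ 0) :
    lossInf D F y ≤ Theta D F * ‖y‖ ^ 2 := by
  have hpos : 0 < ‖y‖ := norm_pos_iff.2 hy
  have hunit : ‖‖y‖⁻¹ • y‖ = 1 := norm_smul_inv_norm (𝕜 := ℝ) hy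
  have h := lossInf_smul_le hD hcone hpos (‖y‖⁻¹ • y)
  rw [smul_inv_smul₀ hpos.ne'] at h
  have hle : lossInf D F (‖y‖⁻¹ • y) ≤ Theta D F :=
    le_csSup (bddAbove_lossInf_sphere hexpr) ⟨_, hunit, rfl⟩
  nlinarith [sq_nonneg ‖y‖]

lemma Theta_lt_one [FiniteDimensional ℝ Y] [Nontrivial Y] (hD : D.Nonempty)
    (hexpr : ∀ y : Y, y ≠ 0 → lossInf D F y < ‖y‖ ^ 2) : Theta D F < 1 := by
  have : ProperSpace Y := FiniteDimensional.proper_real Y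
  have hcont : Continuous fun y : Y => lossInf D F y := by
    simp only [lossInf_eq_infDist_sq hD]
    exact (continuous_infDist_pt _).pow 2
  have hne : (sphere (0 : Y) 1).Nonempty := NormedSpace.sphere_nonempty.2 zero_le_one
  obtain ⟨y, hy, hmax⟩ := (isCompact_sphere (0 : Y) 1).exists_isMaxOn hne hcont.continuousOn
  have hy1 : ‖y‖ = 1 := mem_sphere_zero_iff_norm.1 hy
  have hlt : lossInf D F y < 1 := by
    simpa [hy1] using hexpr y (norm_ne_zero_iff.1 (by simp [hy1]))
  refine lt_of_le_of_lt (csSup_le ⟨_, y, hy1, rfl⟩ ?_) hlt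
  rintro _ ⟨x, hx, rfl⟩
  exact hmax (mem_sphere_zero_iff_norm.2 hx)

end LossInf

section Stationary

variable {Y : Type} [NormedAddCommGroup Y] [InnerProductSpace ℝ Y] {m : ℕ}
  {D : Set (Fin m → ℝ)} {F : (Fin m → ℝ) → Y} {abar : Fin m → ℝ}

lemma hasFDerivAt_sq_norm_sub_zero {F' : (Fin m → ℝ) →L[ℝ] Y} (hF' : HasFDerivAt F F' abar)
    {w : Y} (hw : ∀ i, ⟪F' (Pi.single i 1), w⟫_ℝ = 0) :
    HasFDerivAt (fun α => ‖F α - (F abar + w)‖ ^ 2) (0 : (Fin m → ℝ) →L[ℝ] ℝ) abar := by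
  have h := (hF'.sub_const (F abar + w)).norm_sq
  refine h.congr_fderiv (ContinuousLinearMap.coe_injective ?_)
  ext i
  have := hw i
  rw [real_inner_comm] at this
  simp [this]

/-- If the labels `F abar ± w` both made `abar` a local maximizer, then `F` would be constant on
`D` near `abar`, so `abar` would also be a local minimizer. -/
lemma isLocalMinOn_or_not_isLocalMaxOn_add_or_sub (w : Y) :
    (IsLocalMinOn (fun α => ‖F α - (F abar + w)‖ ^ 2) D abar ∨
      ¬ IsLocalMaxOn (fun α => ‖F α - (F abar + w)‖ ^ 2) D abar) ∨
    ¬ IsLocalMaxOn (fun α => ‖F α - (F abar - w)‖ ^ 2) D abar := by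
  by_contra! hcon
  obtain ⟨⟨hmin, hadd⟩, hsub⟩ := hcon
  refine hmin ?_
  filter_upwards [hadd, hsub] with α h₁ h₂
  have hzero : ‖F α - F abar‖ ^ 2 ≤ 0 := by
    have e₁ : F α - (F abar + w) = (F α - F abar) - w := by abel
    have e₂ : F α - (F abar - w) = (F α - F abar) + w := by abel
    rw [e₁, sub_add_cancel_left, norm_neg, norm_sub_sq_real] at h₁
    rw [e₂, sub_sub_cancel, norm_add_sq_real] at h₂
    linarith
  have hnorm : ‖F α - F abar‖ = 0 := by nlinarith [norm_nonneg (F α - F abar)]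
  rw [sub_eq_zero.1 (norm_eq_zero.1 hnorm)]

end Stationary

theorem nonoptimal_stationary_points {Y : Type} [NormedAddCommGroup Y]
    [InnerProductSpace ℝ Y] [FiniteDimensional ℝ Y] [Nontrivial Y] {m : ℕ}
    (D : Set (Fin m → ℝ)) (hD : D.Nonempty) (F : (Fin m → ℝ) → Y)
    (hcone : ∀ y ∈ F '' D, ∀ s : ℝ, 0 < s → s • y ∈ F '' D)
    (hexpr : ∀ y : Y, y ≠ 0 → lossInf D F y < ‖y‖ ^ 2)
    (abar : Fin m → ℝ) (habar : abar ∈ interior D)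
    (F' : (Fin m → ℝ) →L[ℝ] Y) (hF' : HasFDerivAt F F' abar)
    (hV : Submodule.span ℝ
        ({F abar} ∪ Set.range fun i : Fin m => F' (Pi.single i 1)) ≠ ⊤) :
    (∀ v ∈ (Submodule.span ℝ
        ({F abar} ∪ Set.range fun i : Fin m => F' (Pi.single i 1)))ᗮ, ‖v‖ = 1 →
      ∀ s : ℝ, Real.sqrt (Theta D F / (1 - Theta D F)) * ‖F abar‖ < |s| →
        ∃ τ : ℝ, (τ = 1 ∨ τ = -1) ∧
          spuriousOrSaddle D F abar (F abar + (τ * s) • v)) ∧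
    (∀ C : ℝ, 0 < C → ¬ Set.Countable {y : Y |
      spuriousOrSaddle D F abar y ∧
      (∀ z ∈ bestApprox D F y, C ≤ ‖F abar - z‖ ∧ 1 - 1 / C ≤ ‖F abar - z‖ / ‖z‖) ∧
      lossInf D F y + C ≤ ‖F abar - y‖ ^ 2}) := by
  set V := Submodule.span ℝ ({F abar} ∪ Set.range fun i : Fin m => F' (Pi.single i 1))
  set θ := Theta D F
  have hθ0 : 0 ≤ θ := Theta_nonneg hD
  have hθ1 : θ < 1 := Theta_lt_one hD hexpr
  have hnorm : ∀ v ∈ Vᗮ, ‖v‖ = 1 → ∀ r : ℝ, ‖F abar + r • v‖ ^ 2 = ‖F abar‖ ^ 2 + r ^ 2 := by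
    intro v hv hv1 r
    have horth : ⟪F abar, v⟫_ℝ = 0 := hv _ (Submodule.subset_span (Or.inl rfl))
    rw [norm_add_sq_real, inner_smul_right, horth, norm_smul, hv1, Real.norm_eq_abs, mul_one,
      sq_abs]
    ring
  have hloss : ∀ v ∈ Vᗮ, ‖v‖ = 1 → ∀ r : ℝ, r ≠ 0 →
      lossInf D F (F abar + r • v) ≤ θ * (‖F abar‖ ^ 2 + r ^ 2) := by
    intro v hv hv1 r hr
    rw [← hnorm v hv hv1]
    refine lossInf_le_Theta_mul hD hcone hexpr fun h0 => ?_
    have h := hnorm v hv hv1 r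
    rw [h0, norm_zero] at h
    nlinarith [sq_pos_of_ne_zero hr, sq_nonneg ‖F abar‖]
  have hdist : ∀ v : Y, ‖v‖ = 1 → ∀ r : ℝ, ‖F abar - (F abar + r • v)‖ ^ 2 = r ^ 2 := by
    intro v hv1 r
    rw [sub_add_cancel_left, norm_neg, norm_smul, hv1, mul_one, Real.norm_eq_abs, sq_abs]
  have hfirst : ∀ v ∈ Vᗮ, ‖v‖ = 1 → ∀ s : ℝ, √(θ / (1 - θ)) * ‖F abar‖ < |s| →
      ∃ τ : ℝ, (τ = 1 ∨ τ = -1) ∧ spuriousOrSaddle D F abar (F abar + (τ * s) • v) := by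
    intro v hv hv1 s hs
    have hs0 : s ≠ 0 := abs_pos.1 (lt_of_le_of_lt (by positivity) hs)
    have hs2 : θ * (‖F abar‖ ^ 2 + s ^ 2) < s ^ 2 := by
      have h := pow_lt_pow_left₀ hs (by positivity) two_ne_zero
      rw [mul_pow, Real.sq_sqrt (div_nonneg hθ0 (by linarith)), sq_abs, div_mul_eq_mul_div,
        div_lt_iff₀ (by linarith)] at h
      linarith
    have hstat : ∀ r : ℝ, r ^ 2 = s ^ 2 →
        HasFDerivAt (fun α => ‖F α - (F abar + r • v)‖ ^ 2) (0 : (Fin m → ℝ) →L[ℝ] ℝ) abar ∧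
          ¬ IsMinOn (fun α => ‖F α - (F abar + r • v)‖ ^ 2) D abar := by
      intro r hr
      refine ⟨hasFDerivAt_sq_norm_sub_zero hF' fun i => ?_, fun hmin => ?_⟩
      · rw [inner_smul_right, hv _ (Submodule.subset_span (Or.inr ⟨i, rfl⟩)), mul_zero]
      · have hr0 : r ≠ 0 := by
          rintro rfl
          exact hs0 (by simpa using hr.symm)
        have h₁ := hmin.sq_norm_le_lossInf hD
        have h₂ := hloss v hv hv1 r hr0
        rw [hdist v hv1, hr] at h₁
        rw [hr] at h₂
        linarith
    rcases isLocalMinOn_or_not_isLocalMaxOn_add_or_sub (D := D) (F := F) (abar := abar) (s • v)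
      with h | h
    · refine ⟨1, Or.inl rfl, ?_⟩
      rw [one_mul]
      exact ⟨(hstat s rfl).1, (hstat s rfl).2, h⟩
    · refine ⟨-1, Or.inr rfl, ?_⟩
      rw [neg_one_mul]
      refine ⟨(hstat (-s) (neg_sq s)).1, (hstat (-s) (neg_sq s)).2, Or.inr ?_⟩
      rwa [neg_smul, ← sub_eq_add_neg]
  refine ⟨hfirst, fun C hC hcount => ?_⟩
  obtain ⟨v, hv, hv1⟩ : ∃ v ∈ Vᗮ, ‖v‖ = 1 := by
    obtain ⟨w, hw, hw0⟩ := Submodule.exists_mem_ne_zero_of_ne_bot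
      (mt Submodule.orthogonal_eq_bot_iff.1 hV)
    exact ⟨‖w‖⁻¹ • w, Vᗮ.smul_mem _ hw, norm_smul_inv_norm (𝕜 := ℝ) hw0⟩
  have hsqrt1 : √θ < 1 := by rwa [Real.sqrt_lt' one_pos, one_pow]
  obtain ⟨s₀, hs₀⟩ : ∃ s₀ : ℝ, ∀ s > s₀, 0 < s ∧ √(θ / (1 - θ)) * ‖F abar‖ < s ∧
      C + ‖F abar‖ + C * ‖F abar‖ ≤ (1 - √θ) * s ∧ θ * ‖F abar‖ ^ 2 + C ≤ (1 - θ) * s ^ 2 := by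
    have h : ∀ᶠ s : ℝ in atTop, 0 < s ∧ √(θ / (1 - θ)) * ‖F abar‖ < s ∧
        C + ‖F abar‖ + C * ‖F abar‖ ≤ (1 - √θ) * s ∧
        θ * ‖F abar‖ ^ 2 + C ≤ (1 - θ) * s ^ 2 :=
      (eventually_gt_atTop 0).and <| (eventually_gt_atTop _).and <|
        ((tendsto_id.const_mul_atTop (sub_pos.2 hsqrt1)).eventually_ge_atTop _).and <|
        ((tendsto_pow_atTop two_ne_zero).const_mul_atTop (sub_pos.2 hθ1)).eventually_ge_atTop _
    obtain ⟨s₀, hs₀⟩ := eventually_atTop.1 h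
    exact ⟨s₀, fun s hs => hs₀ s hs.le⟩
  have hIoi : (Set.Ioi s₀).Countable := by
    refine (hcount.image fun y => ‖F abar - y‖).mono fun s hs => ?_
    obtain ⟨hpos, hlarge, hz, hgap⟩ := hs₀ s hs
    obtain ⟨τ, hτ, hsp⟩ := hfirst v hv hv1 s (by rwa [abs_of_pos hpos])
    have hτs : (τ * s) ^ 2 = s ^ 2 := by rcases hτ with rfl | rfl <;> ring
    have hτs0 : τ * s ≠ 0 := by
      intro h0
      rw [h0] at hτs
      nlinarith
    have hl := hloss v hv hv1 _ hτs0
    have hn := hnorm v hv hv1 (τ * s)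
    have hd := hdist v hv1 (τ * s)
    rw [hτs] at hl hn hd
    set y := F abar + (τ * s) • v
    refine ⟨y, ⟨hsp, fun z hzy => ?_, by linarith⟩,
      (sq_eq_sq₀ (norm_nonneg _) hpos.le).1 hd⟩
    have hsy : s ≤ ‖y‖ := le_of_sq_le_sq (by nlinarith [sq_nonneg ‖F abar‖]) (norm_nonneg y)
    have hroot : √(lossInf D F y) ≤ √θ * ‖y‖ := by
      rw [← hn] at hl
      refine (Real.sqrt_le_sqrt hl).trans_eq ?_
      rw [Real.sqrt_mul hθ0, Real.sqrt_sq (norm_nonneg y)]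
    have hzn : C + ‖F abar‖ + C * ‖F abar‖ ≤ ‖z‖ := by
      have h := norm_sub_sqrt_lossInf_le_of_mem_bestApprox hD hzy
      have := mul_le_mul_of_nonneg_left hsy (sub_pos.2 hsqrt1).le
      linarith
    have hF0 := norm_nonneg (F abar)
    have hCF := mul_nonneg hC.le hF0
    have hsub : ‖z‖ - ‖F abar‖ ≤ ‖F abar - z‖ := by
      rw [norm_sub_rev]
      exact norm_sub_norm_le z (F abar)
    refine ⟨by linarith, ?_⟩
    rw [le_div_iff₀ (by linarith)]
    have hquot : ‖F abar‖ ≤ 1 / C * ‖z‖ := by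
      rw [one_div, ← div_eq_inv_mul, le_div_iff₀ hC]
      linarith
    linarith
  have hcard := Cardinal.mk_Ioi_real s₀ ▸ Cardinal.le_aleph0_iff_set_countable.2 hIoi
  exact hcard.not_gt Cardinal.aleph0_lt_continuum
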